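/- There exist constants C₁, C₂ > 0 and thresholds α₀, r₀ ∈ (0,1], all depending only on κ and ν, with the following property. Consider a single-arc packet routing with deterministic queuing with transit time τ > 0, capacity ν > 0, constant κ ≥ ν + 1, a finite commodity set J, and discretization parameters 0 < α ≤ α₀ and 0 < β ≤ r₀·α, together with an associated hypothetical flow over time h⁻. For j ∈ J let m_j := β·(number of packets of commodity j). Then for every θ ≥ 0, every j ∈ J and every particle φ ∈ (0, m_j] with k_{j,u}(φ) ≤ θ: | k_{j,v}(φ) − ℓ^D_{j,v}(⌈φ/β⌉) | ≤ C₁·√α + C₂·θ·√α, i.e., the arrival time of a packet in the packet routing deviates from the hypothetical arrival time of the corresponding particle by at most C₁√α + θ·C₂√α. (Lemma 5.4.) -/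

import Mathlib

open MeasureTheory Finset

/-- The buffer `B(t)`: packets that entered at a step `≤ t − τ̂` (i.e. `ent i + τ̂ ≤ t`)
and have not left at a step `< t`. -/
def buffer {n : ℕ} (ent lv : Fin n → ℕ) (τh t : ℕ) : Finset (Fin n) :=
  Finset.univ.filter (fun i => ent i + τh ≤ t ∧ t ≤ lv i)

/-- **Single-arc packet routing with deterministic queuing** for an arc with transit
time `τ`, capacity `ν`, inflow bound `κ` and discretization parameters `α` (time-step
length) and `β` (packet volume); `τ̂ = ⌈τ/α⌉` and `ν̂ = να/β`. The `n` packets are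
indexed by `Fin n` in FIFO order, each with a commodity `com i` and an entrance step
`entStep i ≥ 1` (monotone in the FIFO order); the total volume entering at any single
step is at most `ακ`. The current capacity `cap` satisfies `cap 1 = ν̂` and the
carry-over recursion, and at each step `t` exactly the first
`min(|B(t)|, ⌊cap t⌋)` packets of the buffer `B(t)` leave the arc. -/
structure PacketRouting (J : Type) [DecidableEq J] (τ ν κ α β : ℝ) where
  n : ℕ
  com : Fin n → J
  entStep : Fin n → ℕ
  entPos : ∀ i, 1 ≤ entStep i
  entMono : Monotone entStep
  volBound : ∀ t : ℕ,
    β * (((Finset.univ : Finset (Fin n)).filter (fun i => entStep i = t)).card : ℝ)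
      ≤ α * κ
  leaveStep : Fin n → ℕ
  leaveGe : ∀ i, entStep i + ⌈τ / α⌉₊ ≤ leaveStep i
  cap : ℕ → ℝ
  cap1 : cap 1 = ν * α / β
  capRec : ∀ t : ℕ, 1 ≤ t → cap (t + 1) =
    if ((buffer entStep leaveStep ⌈τ / α⌉₊ t).card : ℝ) ≤ cap t
    then ν * α / β
    else ν * α / β + cap t - (⌊cap t⌋ : ℝ)
  leaveSpec : ∀ t : ℕ, 1 ≤ t → ∀ i ∈ buffer entStep leaveStep ⌈τ / α⌉₊ t,
    (leaveStep i = t ↔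
      (((buffer entStep leaveStep ⌈τ / α⌉₊ t).filter (fun i' => i' < i)).card : ℤ)
        < min ((buffer entStep leaveStep ⌈τ / α⌉₊ t).card : ℤ) ⌊cap t⌋)

/-- The step function of value `(β/α)·cnt t` on each time interval `((t−1)α, tα]`
(and `0` on `(−∞, 0]`). -/
noncomputable def stepFun (α β : ℝ) (cnt : ℕ → ℕ) : ℝ → ℝ :=
  fun θ => if 0 < θ then β / α * (cnt ⌈θ / α⌉₊ : ℝ) else 0

/-- The cumulative function `θ ↦ ∫₀^θ` of a step function with per-step counts `cnt`. -/
noncomputable def cumStep (α β : ℝ) (cnt : ℕ → ℕ) (θ : ℝ) : ℝ :=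
  ∫ ξ in (0:ℝ)..θ, stepFun α β cnt ξ

variable {J : Type} [DecidableEq J] {τ ν κ α β : ℝ}

/-- Number of packets of commodity `j` entering the arc at step `t`. -/
def entCount (R : PacketRouting J τ ν κ α β) (j : J) (t : ℕ) : ℕ :=
  ((Finset.univ : Finset (Fin R.n)).filter
    (fun i => R.entStep i = t ∧ R.com i = j)).card

/-- Number of packets of commodity `j` leaving the arc at step `t`. -/
def lvCount (R : PacketRouting J τ ν κ α β) (j : J) (t : ℕ) : ℕ :=
  ((Finset.univ : Finset (Fin R.n)).filter
    (fun i => R.leaveStep i = t ∧ R.com i = j)).card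

/-- Total number of packets entering the arc at step `t`. -/
def entCountTot (R : PacketRouting J τ ν κ α β) (t : ℕ) : ℕ :=
  ((Finset.univ : Finset (Fin R.n)).filter (fun i => R.entStep i = t)).card

/-- Total number of packets leaving the arc at step `t`. -/
def lvCountTot (R : PacketRouting J τ ν κ α β) (t : ℕ) : ℕ :=
  ((Finset.univ : Finset (Fin R.n)).filter (fun i => R.leaveStep i = t)).card

/-- Cumulative inflow `G⁺_j` of commodity `j`. -/
noncomputable def Ginj (R : PacketRouting J τ ν κ α β) (j : J) : ℝ → ℝ :=
  cumStep α β (entCount R j)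

/-- Cumulative outflow `G⁻_j` of commodity `j`. -/
noncomputable def Goutj (R : PacketRouting J τ ν κ α β) (j : J) : ℝ → ℝ :=
  cumStep α β (lvCount R j)

/-- Total cumulative inflow `G⁺`. -/
noncomputable def Gin (R : PacketRouting J τ ν κ α β) : ℝ → ℝ :=
  cumStep α β (entCountTot R)

/-- Total cumulative outflow `G⁻`. -/
noncomputable def Gout (R : PacketRouting J τ ν κ α β) : ℝ → ℝ :=
  cumStep α β (lvCountTot R)

/-- The cumulative function `F(θ) = ∫₀^θ f(ξ) dξ` of a rate function `f`. -/
noncomputable def cumul (f : ℝ → ℝ) (θ : ℝ) : ℝ := ∫ ξ in (0:ℝ)..θ, f ξ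

/-- A Vickrey queue flow for an arc with transit time `τ` and capacity `ν`: a pair
`(fi, fo)` of nonnegative, bounded, locally integrable inflow/outflow rates vanishing on
`(−∞, 0)`, whose queue size `z(θ) = F⁺(θ − τ) − F⁻(θ)` is nonnegative, and such that for
almost every `θ`: `fo θ = ν` if `z θ > 0`, and `fo θ = min (fi (θ − τ)) ν` if `z θ = 0`. -/
def IsVickreyFlow (τ' ν' : ℝ) (fi fo : ℝ → ℝ) : Prop :=
  (∀ θ, 0 ≤ fi θ) ∧ (∀ θ, 0 ≤ fo θ) ∧
  (∃ M : ℝ, ∀ θ, fi θ ≤ M ∧ fo θ ≤ M) ∧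
  LocallyIntegrable fi ∧ LocallyIntegrable fo ∧
  (∀ θ < (0:ℝ), fi θ = 0) ∧ (∀ θ < (0:ℝ), fo θ = 0) ∧
  (∀ θ : ℝ, 0 ≤ cumul fi (θ - τ') - cumul fo θ) ∧
  (∀ᵐ θ : ℝ ∂volume,
    (0 < cumul fi (θ - τ') - cumul fo θ → fo θ = ν') ∧
    (cumul fi (θ - τ') - cumul fo θ = 0 → fo θ = min (fi (θ - τ')) ν'))

/-! ### Ranks in finite linear orders -/

lemma image_rank_eq_range {ι : Type*} [LinearOrder ι] (S : Finset ι) :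
    S.image (fun i => (S.filter (fun q => q < i)).card) = Finset.range S.card := by
  have hlt : ∀ a ∈ S, ∀ b, a < b →
      (S.filter (fun q => q < a)).card < (S.filter (fun q => q < b)).card := by
    intro a ha b hab
    refine Finset.card_lt_card ((Finset.ssubset_iff_of_subset ?_).2 ⟨a, ?_, ?_⟩)
    · intro q hq
      simp only [Finset.mem_filter] at hq ⊢
      exact ⟨hq.1, hq.2.trans hab⟩
    · simp [ha, hab]
    · simp
  have hinj : Set.InjOn (fun i => (S.filter (fun q => q < i)).card) (S : Set ι) := by
    intro a ha b hb hab
    rcases lt_trichotomy a b with h | h | h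
    · exact absurd hab (hlt a ha b h).ne
    · exact h
    · exact absurd hab (hlt b hb a h).ne'
  refine Finset.eq_of_subset_of_card_le ?_ ?_
  · intro x hx
    obtain ⟨i, hi, rfl⟩ := Finset.mem_image.1 hx
    refine Finset.mem_range.2 (Finset.card_lt_card ((Finset.ssubset_iff_of_subset
      (Finset.filter_subset _ _)).2 ⟨i, hi, by simp⟩))
  · rw [Finset.card_image_of_injOn hinj, Finset.card_range]

lemma card_filter_rank_lt {ι : Type*} [LinearOrder ι] (S : Finset ι) (m : ℕ) :
    (S.filter (fun i => (S.filter (fun q => q < i)).card < m)).card = min S.card m := by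
  have himg := image_rank_eq_range S
  have hinj : Set.InjOn (fun i => (S.filter (fun q => q < i)).card) (S : Set ι) := by
    rw [← Finset.card_image_iff, himg, Finset.card_range]
  have hsub : ((S.filter (fun i => (S.filter (fun q => q < i)).card < m) : Finset ι) : Set ι)
      ⊆ S := by
    exact_mod_cast Finset.filter_subset _ _
  rw [← Finset.card_image_of_injOn (hinj.mono hsub)]
  have h2 : (S.filter (fun i => (S.filter (fun q => q < i)).card < m)).image
      (fun i => (S.filter (fun q => q < i)).card) = Finset.range (min S.card m) := by
    rw [← Finset.filter_image (p := fun x => x < m), himg]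
    ext x
    simp
  rw [h2, Finset.card_range]

lemma exists_rank_eq {ι : Type*} [LinearOrder ι] (S : Finset ι) {r : ℕ} (hr : r < S.card) :
    ∃ p ∈ S, (S.filter (fun q => q < p)).card = r := by
  have h : r ∈ S.image (fun i => (S.filter (fun q => q < i)).card) := by
    rw [image_rank_eq_range]
    exact Finset.mem_range.2 hr
  simpa using h

lemma sum_card_filter_eq {ι : Type*} (S : Finset ι) {step : ι → ℕ} (hpos : ∀ i, 1 ≤ step i)
    (n : ℕ) :
    ∑ k ∈ Finset.range n, (S.filter (fun i => step i = k + 1)).card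
      = (S.filter (fun i => step i ≤ n)).card := by
  induction n with
  | zero =>
    symm
    simp only [Finset.range_zero, Finset.sum_empty, Finset.card_eq_zero]
    refine Finset.filter_eq_empty_iff.2 fun i _ => ?_
    have := hpos i
    omega
  | succ n ih =>
    classical
    rw [Finset.sum_range_succ, ih, ← Finset.card_union_of_disjoint]
    · congr 1
      ext i
      simp only [Finset.mem_union, Finset.mem_filter, ← and_or_left]
      refine and_congr_right fun _ => ?_
      omega
    · refine Finset.disjoint_filter.2 fun i _ h1 => ?_
      omega

/-! ### Cumulative step functions -/

section StepFunctions

variable {cnt : ℕ → ℕ}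

lemma measurable_stepFun (α β : ℝ) (cnt : ℕ → ℕ) : Measurable (stepFun α β cnt) := by
  unfold stepFun
  refine Measurable.ite measurableSet_Ioi ?_ measurable_const
  refine measurable_const.mul ?_
  have h : Measurable fun k : ℕ => (cnt k : ℝ) := measurable_from_top
  exact h.comp (Nat.measurable_ceil.comp (measurable_id.div_const α))

lemma stepFun_nonneg (hα : 0 < α) (hβ : 0 < β) (cnt : ℕ → ℕ) (x : ℝ) :
    0 ≤ stepFun α β cnt x := by
  unfold stepFun
  split_ifs <;> positivity

lemma stepFun_le {K : ℝ} (hα : 0 < α) (hK : 0 ≤ K) (h : ∀ t, β * (cnt t : ℝ) ≤ α * K) (x : ℝ) :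
    stepFun α β cnt x ≤ K := by
  unfold stepFun
  split_ifs
  · rw [div_mul_eq_mul_div, div_le_iff₀ hα]
    linarith [h ⌈x / α⌉₊]
  · exact hK

lemma intervalIntegrable_stepFun {K : ℝ} (hα : 0 < α) (hβ : 0 < β) (hK : 0 ≤ K)
    (h : ∀ t, β * (cnt t : ℝ) ≤ α * K) (a b : ℝ) :
    IntervalIntegrable (stepFun α β cnt) volume a b := by
  refine (intervalIntegrable_const (c := K)).mono_fun
    (measurable_stepFun α β cnt).aestronglyMeasurable (Filter.Eventually.of_forall fun x => ?_)
  simp only [Real.norm_of_nonneg (stepFun_nonneg hα hβ cnt x), Real.norm_of_nonneg hK]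
  exact stepFun_le hα hK h x

lemma cumStep_sub {K : ℝ} (hα : 0 < α) (hβ : 0 < β) (hK : 0 ≤ K)
    (h : ∀ t, β * (cnt t : ℝ) ≤ α * K) (a b : ℝ) :
    cumStep α β cnt b - cumStep α β cnt a = ∫ x in a..b, stepFun α β cnt x :=
  intervalIntegral.integral_interval_sub_left (intervalIntegrable_stepFun hα hβ hK h _ _)
    (intervalIntegrable_stepFun hα hβ hK h _ _)

lemma cumStep_mono {K : ℝ} (hα : 0 < α) (hβ : 0 < β) (hK : 0 ≤ K)
    (h : ∀ t, β * (cnt t : ℝ) ≤ α * K) : Monotone (cumStep α β cnt) := by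
  intro a b hab
  have h1 := cumStep_sub hα hβ hK h a b
  have h2 : 0 ≤ ∫ x in a..b, stepFun α β cnt x :=
    intervalIntegral.integral_nonneg hab fun x _ => stepFun_nonneg hα hβ cnt x
  linarith

lemma cumStep_sub_le {K : ℝ} (hα : 0 < α) (hβ : 0 < β) (hK : 0 ≤ K)
    (h : ∀ t, β * (cnt t : ℝ) ≤ α * K) {a b : ℝ} (hab : a ≤ b) :
    cumStep α β cnt b - cumStep α β cnt a ≤ K * (b - a) := by
  rw [cumStep_sub hα hβ hK h]
  have := intervalIntegral.integral_mono_on hab (intervalIntegrable_stepFun hα hβ hK h a b)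
    (intervalIntegrable_const (c := K)) (fun x _ => stepFun_le hα hK h x)
  simpa [mul_comm] using this

lemma cumStep_of_nonpos {x : ℝ} (hx : x ≤ 0) : cumStep α β cnt x = 0 := by
  unfold cumStep
  rw [intervalIntegral.integral_symm, neg_eq_zero]
  have : ∀ y ∈ Set.Ioc x 0, stepFun α β cnt y = 0 := fun y hy => by
    simp [stepFun, not_lt.2 hy.2]
  rw [intervalIntegral.integral_of_le hx, setIntegral_congr_fun measurableSet_Ioc this]
  simp

lemma cumStep_natCast_mul {K : ℝ} (hα : 0 < α) (hβ : 0 < β) (hK : 0 ≤ K)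
    (h : ∀ t, β * (cnt t : ℝ) ≤ α * K) (n : ℕ) :
    cumStep α β cnt (n * α) = β * ((∑ k ∈ Finset.range n, cnt (k + 1) : ℕ) : ℝ) := by
  induction n with
  | zero => simp [cumStep]
  | succ n ih =>
    have h1 := cumStep_sub hα hβ hK h (n * α) ((n + 1 : ℕ) * α)
    have hle : (n : ℝ) * α ≤ (n + 1 : ℕ) * α := by push_cast; nlinarith
    have h2 : ∀ y ∈ Set.Ioc ((n : ℝ) * α) ((n + 1 : ℕ) * α),
        stepFun α β cnt y = β / α * (cnt (n + 1) : ℝ) := by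
      intro y hy
      have hy0 : 0 < y := lt_of_le_of_lt (by positivity) hy.1
      have hc : ⌈y / α⌉₊ = n + 1 := by
        rw [Nat.ceil_eq_iff (by omega)]
        refine ⟨?_, ?_⟩
        · rw [lt_div_iff₀ hα]; simpa using hy.1
        · rw [div_le_iff₀ hα]; exact hy.2
      simp [stepFun, hy0, hc]
    rw [intervalIntegral.integral_of_le hle, setIntegral_congr_fun measurableSet_Ioc h2,
      ← intervalIntegral.integral_of_le hle, intervalIntegral.integral_const, smul_eq_mul] at h1
    rw [Finset.sum_range_succ, Nat.cast_add (∑ k ∈ Finset.range n, cnt (k + 1)), mul_add, ← ih]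
    have h3 : (((n + 1 : ℕ) : ℝ) * α - n * α) * (β / α * (cnt (n + 1) : ℝ))
        = β * cnt (n + 1) := by
      push_cast
      field_simp
      ring
    linarith

/-- A particle of the `p`-th packet passes during the time step of that packet. -/
lemma sInf_cumStep_mem_Icc {n : ℕ} (hα : 0 < α) (hβ : 0 < β) (S : Finset (Fin n))
    {step : Fin n → ℕ} (hpos : ∀ i, 1 ≤ step i) (hmono : Monotone step)
    (hcnt : ∀ t, cnt t = (S.filter (fun i => step i = t)).card) {p : Fin n} (hp : p ∈ S) {φ : ℝ}
    (hlo : β * ((S.filter (fun q => q < p)).card : ℝ) < φ)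
    (hhi : φ ≤ β * ((S.filter (fun q => q < p)).card + 1)) :
    sInf {x : ℝ | 0 ≤ x ∧ φ ≤ cumStep α β cnt x} ∈
      Set.Icc (((step p : ℝ) - 1) * α) (step p * α) := by
  have hK : (0 : ℝ) ≤ β * n / α := by positivity
  have hb : ∀ t, β * (cnt t : ℝ) ≤ α * (β * n / α) := by
    intro t
    rw [mul_div_cancel₀ _ hα.ne']
    have : cnt t ≤ n := by
      rw [hcnt]
      exact (Finset.card_le_univ _).trans (by simp)
    have : (cnt t : ℝ) ≤ n := by exact_mod_cast this
    nlinarith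
  have hval : ∀ m : ℕ, cumStep α β cnt (m * α)
      = β * ((S.filter (fun i => step i ≤ m)).card : ℝ) := by
    intro m
    rw [cumStep_natCast_mul hα hβ hK hb, ← sum_card_filter_eq S hpos]
    simp [hcnt]
  have hmem : (step p : ℝ) * α ∈ {x : ℝ | 0 ≤ x ∧ φ ≤ cumStep α β cnt x} := by
    refine ⟨by positivity, hhi.trans ?_⟩
    rw [hval]
    have hsub : insert p (S.filter (fun q => q < p)) ⊆ S.filter (fun i => step i ≤ step p) := by
      intro q hq
      rcases Finset.mem_insert.1 hq with rfl | hq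
      · simp [hp]
      · rw [Finset.mem_filter] at hq ⊢
        exact ⟨hq.1, hmono hq.2.le⟩
    have := Finset.card_le_card hsub
    rw [Finset.card_insert_of_notMem (by simp)] at this
    have : ((S.filter (fun q => q < p)).card : ℝ) + 1
        ≤ ((S.filter (fun i => step i ≤ step p)).card : ℝ) := by exact_mod_cast this
    nlinarith
  refine ⟨le_csInf ⟨_, hmem⟩ ?_, csInf_le ⟨0, fun x hx => hx.1⟩ hmem⟩
  rintro x ⟨-, hx⟩
  by_contra! hlt
  have h1 := cumStep_mono hα hβ hK hb hlt.le
  obtain ⟨m, hm⟩ : ∃ m, step p = m + 1 := ⟨step p - 1, by have := hpos p; omega⟩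
  have h2 : ((step p : ℝ) - 1) * α = m * α := by rw [hm]; push_cast; ring
  rw [h2, hval] at h1
  have hsub : S.filter (fun i => step i ≤ m) ⊆ S.filter (fun q => q < p) := by
    intro q hq
    rw [Finset.mem_filter] at hq ⊢
    refine ⟨hq.1, ?_⟩
    by_contra! hpq
    have := hmono hpq
    omega
  have : ((S.filter (fun i => step i ≤ m)).card : ℝ) ≤ ((S.filter (fun q => q < p)).card : ℝ) := by
    exact_mod_cast Finset.card_le_card hsub
  nlinarith

end StepFunctions

/-! ### Vickrey queue flows -/

section Vickrey

variable {fi fo : ℝ → ℝ}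

lemma intervalIntegrable_of_locallyIntegrable (hf : LocallyIntegrable fo) (a b : ℝ) :
    IntervalIntegrable fo volume a b :=
  (hf.integrableOn_isCompact isCompact_uIcc).intervalIntegrable

lemma cumul_sub (hf : LocallyIntegrable fo) (a b : ℝ) :
    cumul fo b - cumul fo a = ∫ x in a..b, fo x :=
  intervalIntegral.integral_interval_sub_left (intervalIntegrable_of_locallyIntegrable hf _ _)
    (intervalIntegrable_of_locallyIntegrable hf _ _)

lemma continuous_cumul (hf : LocallyIntegrable fo) : Continuous (cumul fo) :=
  intervalIntegral.continuous_primitive (intervalIntegrable_of_locallyIntegrable hf) 0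

lemma IsVickreyFlow.outflow_le (h : IsVickreyFlow τ ν fi fo) {s θ : ℝ} (hs : s ≤ θ) :
    cumul fo θ ≤ cumul fi (s - τ) + ν * (θ - s) := by
  obtain ⟨-, -, -, -, hfo, -, -, hz, hae⟩ := h
  have h1 := cumul_sub hfo s θ
  have h2 : ∫ x in s..θ, fo x ≤ ∫ x in s..θ, ν := by
    refine intervalIntegral.integral_mono_ae hs
      (intervalIntegrable_of_locallyIntegrable hfo _ _) intervalIntegrable_const ?_
    filter_upwards [hae] with x hx
    rcases (hz x).lt_or_eq with h | h
    · exact (hx.1 h).le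
    · rw [hx.2 h.symm]
      exact min_le_right _ _
  rw [intervalIntegral.integral_const, smul_eq_mul] at h2
  have := hz s
  linarith

lemma IsVickreyFlow.exists_le_outflow (h : IsVickreyFlow τ ν fi fo) (hτ : 0 < τ) {θ : ℝ}
    (hθ : 0 ≤ θ) :
    ∃ s, 0 ≤ s ∧ s ≤ θ ∧ cumul fi (s - τ) + ν * (θ - s) ≤ cumul fo θ := by
  obtain ⟨-, -, -, hfi, hfo, hneg, -, hz, hae⟩ := h
  set z : ℝ → ℝ := fun x => cumul fi (x - τ) - cumul fo x with hzdef
  have hcont : Continuous z :=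
    ((continuous_cumul hfi).comp (continuous_id.sub continuous_const)).sub (continuous_cumul hfo)
  have hz0 : z 0 = 0 := by
    have h1 : cumul fi (0 - τ) = 0 := by
      unfold cumul
      rw [intervalIntegral.integral_symm, neg_eq_zero,
        intervalIntegral.integral_of_le (by linarith), integral_Ioc_eq_integral_Ioo,
        setIntegral_congr_fun measurableSet_Ioo (fun y hy => hneg y hy.2)]
      simp
    simp only [hzdef, h1]
    simp [cumul]
  set Z : Set ℝ := Set.Icc 0 θ ∩ z ⁻¹' {0} with hZ
  have hZc : IsCompact Z := isCompact_Icc.inter_right (isClosed_singleton.preimage hcont)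
  have hZn : Z.Nonempty := ⟨0, ⟨le_rfl, hθ⟩, hz0⟩
  obtain ⟨s, ⟨⟨hs0, hsθ⟩, hzs⟩, hmax⟩ := hZc.exists_isGreatest hZn
  refine ⟨s, hs0, hsθ, ?_⟩
  have hzs' : cumul fi (s - τ) - cumul fo s = 0 := hzs
  have h1 := cumul_sub hfo s θ
  have h2 : ∫ x in s..θ, fo x = ∫ x in s..θ, ν := by
    refine intervalIntegral.integral_congr_ae ?_
    filter_upwards [hae] with x hx hxm
    rw [Set.uIoc_of_le hsθ] at hxm
    refine hx.1 ((hz x).lt_of_ne fun h0 => ?_)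
    have : x ≤ s := hmax ⟨⟨hs0.trans hxm.1.le, hxm.2⟩, h0.symm⟩
    exact absurd hxm.1 (not_lt.2 this)
  rw [intervalIntegral.integral_const, smul_eq_mul] at h2
  linarith

end Vickrey

/-! ### The packet routing -/

namespace PacketRouting

variable (R : PacketRouting J τ ν κ α β)

/-- Number of packets that entered at a step `≤ t - τ̂`. -/
noncomputable def arrived (t : ℕ) : ℕ :=
  (Finset.univ.filter (fun i => R.entStep i + ⌈τ / α⌉₊ ≤ t)).card

/-- Number of packets that left at a step `≤ t`. -/
def departed (t : ℕ) : ℕ :=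
  (Finset.univ.filter (fun i => R.leaveStep i ≤ t)).card

/-- Number of packets in the buffer at step `t`. -/
noncomputable def bufferCard (t : ℕ) : ℕ := (buffer R.entStep R.leaveStep ⌈τ / α⌉₊ t).card

lemma one_le_leaveStep (i : Fin R.n) : 1 ≤ R.leaveStep i := by
  have h1 := R.entPos i
  have h2 := R.leaveGe i
  omega

lemma leaveStep_mono : Monotone R.leaveStep := by
  intro q p hqp
  by_contra! hlt
  have hp : p ∈ buffer R.entStep R.leaveStep ⌈τ / α⌉₊ (R.leaveStep p) := by
    simp [buffer, R.leaveGe p]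
  have hq : q ∈ buffer R.entStep R.leaveStep ⌈τ / α⌉₊ (R.leaveStep p) := by
    have h1 := R.entMono hqp
    have h2 := R.leaveGe p
    simp only [buffer, Finset.mem_filter, Finset.mem_univ, true_and]
    omega
  have h1 := (R.leaveSpec _ (R.one_le_leaveStep p) p hp).1 rfl
  have h2 := (R.leaveSpec _ (R.one_le_leaveStep p) q hq).2 (lt_of_le_of_lt ?_ h1)
  · omega
  · gcongr

lemma arrived_mono : Monotone R.arrived := by
  intro s t hst
  unfold arrived
  gcongr

lemma arrived_succ (t : ℕ) : R.arrived (t + 1) = R.bufferCard (t + 1) + R.departed t := by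
  unfold arrived bufferCard departed buffer
  rw [← Finset.card_union_of_disjoint]
  · congr 1
    ext i
    have := R.leaveGe i
    simp only [Finset.mem_union, Finset.mem_filter, Finset.mem_univ, true_and]
    omega
  · refine Finset.disjoint_filter.2 fun i _ h1 => ?_
    omega

lemma cap_mem_Ico {t : ℕ} (ht : 1 ≤ t) :
    R.cap t ∈ Set.Ico (ν * α / β) (ν * α / β + 1) := by
  induction t, ht using Nat.le_induction with
  | base => rw [R.cap1]; simp
  | succ t ht ih =>
    rw [R.capRec t ht]
    split_ifs
    · simp
    · have h1 := Int.floor_le (R.cap t)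
      have h2 := Int.lt_floor_add_one (R.cap t)
      constructor <;> linarith

lemma departed_succ (hc : 0 ≤ ν * α / β) (t : ℕ) :
    R.departed (t + 1) = R.departed t + min (R.bufferCard (t + 1)) ⌊R.cap (t + 1)⌋₊ := by
  have hfl : ((⌊R.cap (t + 1)⌋₊ : ℕ) : ℤ) = ⌊R.cap (t + 1)⌋ :=
    Int.natCast_floor_eq_floor (hc.trans (R.cap_mem_Ico (by omega)).1)
  unfold bufferCard
  rw [← card_filter_rank_lt, departed, departed, ← Finset.card_union_of_disjoint]
  · congr 1
    ext i
    simp only [Finset.mem_union, Finset.mem_filter, Finset.mem_univ, true_and]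
    have hspec := R.leaveSpec (t + 1) (by omega) i
    have hge := R.leaveGe i
    constructor
    · intro hi
      rcases Nat.lt_or_ge t (R.leaveStep i) with h | h
      · have heq : R.leaveStep i = t + 1 := by omega
        have hb : i ∈ buffer R.entStep R.leaveStep ⌈τ / α⌉₊ (t + 1) := by
          simp only [buffer, Finset.mem_filter, Finset.mem_univ, true_and]
          omega
        have := (lt_min_iff.1 ((hspec hb).1 heq)).2
        rw [← hfl] at this
        exact Or.inr ⟨hb, by exact_mod_cast this⟩
      · exact Or.inl h
    · rintro (h | ⟨hb, h⟩)
      · omega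
      · refine ((hspec hb).2 (lt_min_iff.2 ⟨?_, ?_⟩)).le
        · exact_mod_cast Finset.card_lt_card ((Finset.ssubset_iff_of_subset
            (Finset.filter_subset _ _)).2 ⟨i, hb, by simp⟩)
        · rw [← hfl]
          exact_mod_cast h
  · refine Finset.disjoint_left.2 fun i h1 h2 => ?_
    have h3 := (Finset.mem_filter.1 h2).1
    simp only [buffer, Finset.mem_filter, Finset.mem_univ, true_and] at h1 h3
    omega

lemma departed_le_arrived (t : ℕ) : R.departed t ≤ R.arrived t := by
  refine Finset.card_le_card fun i hi => ?_
  simp only [Finset.mem_filter, Finset.mem_univ, true_and] at hi ⊢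
  exact (R.leaveGe i).trans hi

lemma departed_succ_le (hc : 0 ≤ ν * α / β) (t : ℕ) :
    (R.departed (t + 1) : ℝ) ≤
      R.departed t + (ν * α / β + R.cap (t + 1) - R.cap (t + 2)) := by
  have hcap := R.cap_mem_Ico (t := t + 1) (by omega)
  have hrec := R.capRec (t + 1) (by omega)
  rw [R.departed_succ hc]
  push_cast
  by_cases h : (R.bufferCard (t + 1) : ℝ) ≤ R.cap (t + 1)
  · replace hrec := hrec.trans (if_pos h)
    have := min_le_left (R.bufferCard (t + 1) : ℝ) (⌊R.cap (t + 1)⌋₊ : ℝ)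
    linarith
  · replace hrec := hrec.trans (if_neg h)
    have := min_le_right (R.bufferCard (t + 1) : ℝ) (⌊R.cap (t + 1)⌋₊ : ℝ)
    rw [natCast_floor_eq_intCast_floor (hc.trans hcap.1)] at this ⊢
    linarith

lemma departed_sub_le (hc : 0 ≤ ν * α / β) (s d : ℕ) :
    (R.departed (s + d) : ℝ) ≤
      R.departed s + (ν * α / β * d + R.cap (s + 1) - R.cap (s + d + 1)) := by
  induction d with
  | zero => simp
  | succ d ih =>
    have := R.departed_succ_le hc (s + d)
    rw [← add_assoc]
    push_cast
    have e : s + d + 2 = s + d + 1 + 1 := rfl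
    rw [e] at this
    linarith

lemma departed_le (hc : 0 ≤ ν * α / β) {s t : ℕ} (hst : s ≤ t) :
    (R.departed t : ℝ) ≤ R.arrived s + ν * α / β * ((t : ℝ) - s) + 1 := by
  obtain ⟨d, rfl⟩ := Nat.exists_eq_add_of_le hst
  have h1 := R.departed_sub_le hc s d
  have h2 : (R.departed s : ℝ) ≤ R.arrived s := by exact_mod_cast R.departed_le_arrived s
  have h3 := (R.cap_mem_Ico (t := s + 1) (by omega)).2
  have h4 := (R.cap_mem_Ico (t := s + d + 1) (by omega)).1
  push_cast
  have h5 : ν * α / β * ((s : ℝ) + d - s) = ν * α / β * d := by ring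
  linarith

lemma exists_lt_departed (hc : 0 ≤ ν * α / β) (t : ℕ) :
    ∃ s ≤ t, (R.arrived s : ℝ) + ν * α / β * ((t : ℝ) - s) - 1 < R.departed t := by
  suffices h : ∃ s ≤ t, (R.arrived s : ℝ) + ν * α / β * ((t : ℝ) - s)
      + R.cap (s + 1) - R.cap (t + 1) ≤ R.departed t by
    obtain ⟨s, hst, hs⟩ := h
    have h3 := (R.cap_mem_Ico (t := s + 1) (by omega)).1
    have h4 := (R.cap_mem_Ico (t := t + 1) (by omega)).2
    exact ⟨s, hst, by linarith⟩
  induction t with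
  | zero =>
    refine ⟨0, le_rfl, ?_⟩
    have : R.arrived 0 = 0 := by
      unfold arrived
      rw [Finset.card_eq_zero, Finset.filter_eq_empty_iff]
      intro i _
      have := R.entPos i
      omega
    simp [this]
  | succ t ih =>
    have hcap := R.cap_mem_Ico (t := t + 1) (by omega)
    have hrec := R.capRec (t + 1) (by omega)
    have hdep := R.departed_succ hc t
    have hfl := natCast_floor_eq_intCast_floor (hc.trans hcap.1)
    by_cases h : (R.bufferCard (t + 1) : ℝ) ≤ R.cap (t + 1)
    · refine ⟨t + 1, le_rfl, ?_⟩
      have h1 : R.bufferCard (t + 1) ≤ ⌊R.cap (t + 1)⌋₊ := Nat.le_floor h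
      rw [min_eq_left h1, add_comm (R.departed t), ← R.arrived_succ] at hdep
      simp [hdep]
    · replace hrec := hrec.trans (if_neg h)
      obtain ⟨s, hst, hs⟩ := ih
      refine ⟨s, hst.trans (Nat.le_succ t), ?_⟩
      have h1 : ⌊R.cap (t + 1)⌋₊ ≤ R.bufferCard (t + 1) := by
        have := Nat.floor_le (hc.trans hcap.1)
        exact_mod_cast this.trans (not_le.1 h).le
      rw [min_eq_right h1] at hdep
      rw [hdep]
      push_cast
      rw [hfl]
      linarith

lemma Gin_sub_eq (hα : 0 < α) (hβ : 0 < β) (hκ : 0 ≤ κ) (s : ℕ) :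
    Gin R (((s : ℝ) - ⌈τ / α⌉₊) * α) = β * R.arrived s := by
  rcases le_total ⌈τ / α⌉₊ s with h | h
  · obtain ⟨d, rfl⟩ := Nat.exists_eq_add_of_le h
    have h1 : (((⌈τ / α⌉₊ + d : ℕ) : ℝ) - ⌈τ / α⌉₊) * α = d * α := by push_cast; ring
    rw [h1, Gin, cumStep_natCast_mul (cnt := entCountTot R) hα hβ hκ R.volBound]
    unfold entCountTot
    rw [sum_card_filter_eq _ R.entPos, arrived]
    simp only [add_comm ⌈τ / α⌉₊ d, add_le_add_iff_right]
  · have h1 : ((s : ℝ) - ⌈τ / α⌉₊) * α ≤ 0 := by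
      have : (s : ℝ) ≤ ⌈τ / α⌉₊ := by exact_mod_cast h
      nlinarith
    have h2 : R.arrived s = 0 := by
      unfold arrived
      rw [Finset.card_eq_zero, Finset.filter_eq_empty_iff]
      intro i _
      have := R.entPos i
      omega
    rw [Gin, cumStep_of_nonpos h1, h2]
    simp

lemma val_lt_arrived (p : Fin R.n) : p.val < R.arrived (R.entStep p + ⌈τ / α⌉₊) := by
  rw [Nat.lt_iff_add_one_le, ← Fin.card_Iic]
  refine Finset.card_le_card fun q hq => ?_
  have := R.entMono (Finset.mem_Iic.1 hq)
  simp only [Finset.mem_filter, Finset.mem_univ, true_and]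
  omega

lemma arrived_le_val (p : Fin R.n) {t : ℕ} (ht : t < R.entStep p + ⌈τ / α⌉₊) :
    R.arrived t ≤ p.val := by
  rw [← Fin.card_Iio]
  refine Finset.card_le_card fun q hq => ?_
  simp only [Finset.mem_filter, Finset.mem_univ, true_and] at hq
  refine Finset.mem_Iio.2 (not_le.1 fun hpq => ?_)
  have := R.entMono hpq
  omega

lemma val_lt_departed (p : Fin R.n) : p.val < R.departed (R.leaveStep p) := by
  rw [Nat.lt_iff_add_one_le, ← Fin.card_Iic]
  refine Finset.card_le_card fun q hq => ?_
  simpa using R.leaveStep_mono (Finset.mem_Iic.1 hq)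

lemma departed_le_val (p : Fin R.n) {t : ℕ} (ht : t < R.leaveStep p) :
    R.departed t ≤ p.val := by
  rw [← Fin.card_Iio]
  refine Finset.card_le_card fun q hq => ?_
  simp only [Finset.mem_filter, Finset.mem_univ, true_and] at hq
  refine Finset.mem_Iio.2 (not_le.1 fun hpq => ?_)
  have := R.leaveStep_mono hpq
  omega

/-- The cumulative inflow at a time within the entrance step of a packet is within one step's
volume of the volume of all packets up to this one. -/
lemma abs_Gin_sub_rank_le (hα : 0 < α) (hβ : 0 < β) (hκ : 0 ≤ κ) (p : Fin R.n) {ku : ℝ}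
    (hku : ku ∈ Set.Icc (((R.entStep p : ℝ) - 1) * α) (R.entStep p * α)) :
    |Gin R ku - β * ((p.val : ℝ) + 1)| ≤ κ * α := by
  have hmono : Monotone (Gin R) := cumStep_mono hα hβ hκ R.volBound
  have h1 := R.Gin_sub_eq hα hβ hκ (R.entStep p + ⌈τ / α⌉₊)
  have h2 := R.Gin_sub_eq hα hβ hκ (R.entStep p + ⌈τ / α⌉₊ - 1)
  have hpos := R.entPos p
  rw [Nat.cast_sub (by omega)] at h2
  push_cast at h1 h2
  rw [show (R.entStep p : ℝ) + ⌈τ / α⌉₊ - ⌈τ / α⌉₊ = R.entStep p by ring] at h1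
  rw [show (R.entStep p : ℝ) + ⌈τ / α⌉₊ - 1 - ⌈τ / α⌉₊ = R.entStep p - 1 by ring] at h2
  have h3 : (p.val : ℝ) + 1 ≤ R.arrived (R.entStep p + ⌈τ / α⌉₊) := by
    exact_mod_cast R.val_lt_arrived p
  have h4 : (R.arrived (R.entStep p + ⌈τ / α⌉₊ - 1) : ℝ) ≤ (p.val : ℝ) := by
    exact_mod_cast R.arrived_le_val p (t := R.entStep p + ⌈τ / α⌉₊ - 1) (by omega)
  have h5 : Gin R (R.entStep p * α) - Gin R (((R.entStep p : ℝ) - 1) * α) ≤ κ * α := by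
    have := cumStep_sub_le hα hβ hκ R.volBound (hku.1.trans hku.2)
    rw [show (R.entStep p : ℝ) * α - ((R.entStep p : ℝ) - 1) * α = α by ring] at this
    exact this
  have h6 := hmono hku.1
  have h7 := hmono hku.2
  have h8 := mul_le_mul_of_nonneg_left h3 hβ.le
  have h9 := mul_le_mul_of_nonneg_left h4 hβ.le
  rw [abs_le]
  constructor <;> linarith

lemma arrival_sub_leaveStep_le {hout : ℝ → ℝ} (hν : 0 < ν) (hτ : 0 < τ) (hα : 0 < α)
    (hβ : 0 < β) (hκ : 0 ≤ κ) (h : IsVickreyFlow τ ν (stepFun α β (entCountTot R)) hout)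
    (p : Fin R.n) {ku : ℝ}
    (hku : ku ∈ Set.Icc (((R.entStep p : ℝ) - 1) * α) (R.entStep p * α)) :
    ν * (ku + τ) + (Gin R ku - cumul hout (ku + τ)) - ν * (R.leaveStep p * α)
      ≤ β + 2 * κ * α := by
  have hpos : (1 : ℝ) ≤ R.entStep p := by exact_mod_cast R.entPos p
  have hku0 : 0 ≤ ku := le_trans (mul_nonneg (by linarith) hα.le) hku.1
  have hc : 0 ≤ ν * α / β := by positivity
  obtain ⟨s, hs0, hsθ, hs⟩ := h.exists_le_outflow hτ (θ := ku + τ) (by linarith)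
  change Gin R (s - τ) + _ ≤ _ at hs
  have hτc : τ ≤ ⌈τ / α⌉₊ * α := (div_le_iff₀ hα).1 (Nat.le_ceil _)
  have hsc : s ≤ ⌈s / α⌉₊ * α := (div_le_iff₀ hα).1 (Nat.le_ceil _)
  have hsc' : (⌈s / α⌉₊ : ℝ) * α ≤ s + α := by
    have := (Nat.ceil_lt_add_one (div_nonneg hs0 hα.le)).le
    have := mul_le_mul_of_nonneg_right this hα.le
    rwa [add_mul, div_mul_cancel₀ _ hα.ne', one_mul] at this
  have hsT : ⌈s / α⌉₊ ≤ R.leaveStep p := by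
    refine le_trans (Nat.ceil_le.2 ?_) (R.leaveGe p)
    rw [div_le_iff₀ hα]
    push_cast
    linarith [hku.2]
  have h1 := R.departed_le hc hsT
  have h2 : (p.val : ℝ) + 1 ≤ R.departed (R.leaveStep p) := by
    exact_mod_cast R.val_lt_departed p
  have h3 := mul_le_mul_of_nonneg_left (h2.trans h1) hβ.le
  have h4 : β * ((R.arrived ⌈s / α⌉₊ : ℝ) + ν * α / β * ((R.leaveStep p : ℝ) - ⌈s / α⌉₊) + 1)
      = β * R.arrived ⌈s / α⌉₊ + ν * (R.leaveStep p * α) - ν * (⌈s / α⌉₊ * α) + β := by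
    field_simp
    ring
  rw [h4, ← R.Gin_sub_eq hα hβ hκ] at h3
  have h5 := (abs_le.1 (R.abs_Gin_sub_rank_le hα hβ hκ p hku)).2
  have h6 : Gin R (((⌈s / α⌉₊ : ℝ) - ⌈τ / α⌉₊) * α) ≤ Gin R (s - τ) + κ * α := by
    have hmono : Monotone (Gin R) := cumStep_mono hα hβ hκ R.volBound
    have h7 := cumStep_sub_le hα hβ hκ R.volBound (show s - τ ≤ s - τ + α by linarith)
    rw [add_sub_cancel_left] at h7
    have h8 : Gin R (((⌈s / α⌉₊ : ℝ) - ⌈τ / α⌉₊) * α) ≤ Gin R (s - τ + α) :=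
      hmono (by linarith)
    change Gin R _ - Gin R _ ≤ _ at h7
    linarith
  have h9 := mul_le_mul_of_nonneg_left hsc hν.le
  linarith

lemma leaveStep_sub_arrival_le {hout : ℝ → ℝ} (hν : 0 < ν) (hτ : 0 < τ) (hα : 0 < α)
    (hβ : 0 < β) (hκ : 0 ≤ κ) (h : IsVickreyFlow τ ν (stepFun α β (entCountTot R)) hout)
    (p : Fin R.n) {ku : ℝ}
    (hku : ku ∈ Set.Icc (((R.entStep p : ℝ) - 1) * α) (R.entStep p * α)) :
    ν * (R.leaveStep p * α) - (ν * (ku + τ) + (Gin R ku - cumul hout (ku + τ)))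
      ≤ κ * α + 2 * ν * α := by
  have hc : 0 < ν * α / β := by positivity
  obtain ⟨l, hl⟩ : ∃ l, R.leaveStep p = l + 1 :=
    ⟨R.leaveStep p - 1, by have := R.one_le_leaveStep p; omega⟩
  obtain ⟨s, hsl, hs⟩ := R.exists_lt_departed hc.le l
  have h1 : (R.departed l : ℝ) ≤ (p.val : ℝ) := by
    exact_mod_cast R.departed_le_val p (t := l) (by omega)
  have hsT : s < R.entStep p + ⌈τ / α⌉₊ := by
    by_contra! hle
    have h2 : (p.val : ℝ) + 1 ≤ R.arrived s := by
      exact_mod_cast (R.val_lt_arrived p).trans_le (R.arrived_mono hle)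
    have h3 : (0 : ℝ) ≤ ν * α / β * ((l : ℝ) - s) :=
      mul_nonneg hc.le (sub_nonneg.2 (by exact_mod_cast hsl))
    linarith
  have hsT' : (s : ℝ) ≤ R.entStep p + ⌈τ / α⌉₊ - 1 := by
    have : (s : ℝ) + 1 ≤ R.entStep p + ⌈τ / α⌉₊ := by exact_mod_cast hsT
    linarith
  have hτc : (⌈τ / α⌉₊ : ℝ) * α ≤ τ + α := by
    have := (Nat.ceil_lt_add_one (div_nonneg hτ.le hα.le)).le
    have := mul_le_mul_of_nonneg_right this hα.le
    rwa [add_mul, div_mul_cancel₀ _ hα.ne', one_mul] at this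
  have hsle : ((s : ℝ) - ⌈τ / α⌉₊) * α + τ ≤ ku + τ := by
    have : ((s : ℝ) - ⌈τ / α⌉₊) * α ≤ ((R.entStep p : ℝ) - 1) * α :=
      mul_le_mul_of_nonneg_right (by linarith) hα.le
    linarith [hku.1]
  have h4 := h.outflow_le hsle
  rw [add_sub_cancel_right] at h4
  change _ ≤ Gin R _ + _ at h4
  rw [R.Gin_sub_eq hα hβ hκ] at h4
  have h5 := (abs_le.1 (R.abs_Gin_sub_rank_le hα hβ hκ p hku)).1
  have h6 := mul_le_mul_of_nonneg_left (hs.le.trans h1) hβ.le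
  have h7 : β * ((R.arrived s : ℝ) + ν * α / β * ((l : ℝ) - s) - 1)
      = β * R.arrived s + ν * (l * α) - ν * (s * α) - β := by
    field_simp
    ring
  have h8 := mul_le_mul_of_nonneg_left hτc hν.le
  rw [h7] at h6
  rw [hl]
  push_cast
  nlinarith

end PacketRouting

/-- **Lemma 5.4.** There are constants `C₁, C₂ > 0` and thresholds `α₀, r₀ ∈ (0,1]`,
depending only on `κ` and `ν`, such that for every single-arc packet routing with finite
commodity set `J`, `0 < α ≤ α₀`, `0 < β ≤ r₀·α` and an associated hypothetical flow over
time `hout` (i.e. `(g⁺, hout)` is a Vickrey queue flow, `H⁻ = cumul hout`), for every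
time `θ ≥ 0`, commodity `j` and particle `φ ∈ (0, m_j]` with hypothetical entrance time
`k_{j,u}(φ) ≤ θ`, the hypothetical arrival time
`k_{j,v}(φ) = k_{j,u}(φ) + τ + (G⁺(k_{j,u}(φ)) − H⁻(k_{j,u}(φ) + τ))/ν` deviates from
the refined departure time `ℓ^D_{j,v}(⌈φ/β⌉)` of the corresponding packet by at most
`C₁·√α + C₂·θ·√α`. -/
theorem discrete_vs_hypothetical_arrival (ν κ : ℝ) (hν : 0 < ν) (hκ : ν + 1 ≤ κ) :
    ∃ C₁ C₂ α₀ r₀ : ℝ, 0 < C₁ ∧ 0 < C₂ ∧ (0 < α₀ ∧ α₀ ≤ 1) ∧ (0 < r₀ ∧ r₀ ≤ 1) ∧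
      ∀ (J : Type) [Fintype J] [DecidableEq J] (τ α β : ℝ),
        0 < τ → 0 < α → α ≤ α₀ → 0 < β → β ≤ r₀ * α →
        ∀ (R : PacketRouting J τ ν κ α β) (hout : ℝ → ℝ),
          IsVickreyFlow τ ν (stepFun α β (entCountTot R)) hout →
          ∀ θ : ℝ, 0 ≤ θ → ∀ (j : J) (φ : ℝ), 0 < φ →
            φ ≤ β * (((Finset.univ : Finset (Fin R.n)).filter
              (fun p => R.com p = j)).card : ℝ) →
            ∀ ku : ℝ, ku = sInf {x : ℝ | 0 ≤ x ∧ φ ≤ Ginj R j x} → ku ≤ θ →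
              |(ku + τ + (Gin R ku - cumul hout (ku + τ)) / ν) -
                  sInf {x : ℝ | 0 ≤ x ∧ (⌈φ / β⌉₊ : ℝ) * β ≤ Goutj R j x}| ≤
                C₁ * Real.sqrt α + C₂ * θ * Real.sqrt α := by
  have hκ0 : 0 ≤ κ := by linarith
  refine ⟨(2 * κ + 2 * ν + 1) / ν + 1, 1, 1, 1, by positivity, one_pos, ⟨one_pos, le_rfl⟩,
    ⟨one_pos, le_rfl⟩, ?_⟩
  intro J _ _ τ α β hτ hα hα1 hβ hβα R hout hV θ hθ j φ hφ hφm ku hku hkuθ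
  set S := (Finset.univ : Finset (Fin R.n)).filter (fun p => R.com p = j) with hS
  have hi1 : 0 < ⌈φ / β⌉₊ := Nat.ceil_pos.2 (by positivity)
  have him : ⌈φ / β⌉₊ ≤ S.card := by
    rw [Nat.ceil_le, div_le_iff₀ hβ]
    linarith
  obtain ⟨p, hpS, hp⟩ := exists_rank_eq S (r := ⌈φ / β⌉₊ - 1) (by omega)
  have hpc : ((S.filter (fun q => q < p)).card : ℝ) + 1 = ⌈φ / β⌉₊ := by
    rw [hp, Nat.cast_sub hi1]
    simp
  have hlo : β * ((S.filter (fun q => q < p)).card : ℝ) < φ := by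
    have := (Nat.ceil_lt_add_one (div_pos hφ hβ).le)
    have h2 : ((S.filter (fun q => q < p)).card : ℝ) < φ / β := by linarith
    rw [lt_div_iff₀ hβ] at h2
    linarith
  have hhi : φ ≤ β * (((S.filter (fun q => q < p)).card : ℝ) + 1) := by
    rw [hpc]
    have := (div_le_iff₀ hβ).1 (Nat.le_ceil (φ / β))
    linarith
  have hu : ku ∈ Set.Icc (((R.entStep p : ℝ) - 1) * α) (R.entStep p * α) := by
    rw [hku]
    refine sInf_cumStep_mem_Icc hα hβ S R.entPos R.entMono (fun t => ?_) hpS hlo hhi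
    rw [hS, Finset.filter_filter, entCount]
    simp only [and_comm]
  have hv : sInf {x : ℝ | 0 ≤ x ∧ (⌈φ / β⌉₊ : ℝ) * β ≤ Goutj R j x} ∈
      Set.Icc (((R.leaveStep p : ℝ) - 1) * α) (R.leaveStep p * α) := by
    refine sInf_cumStep_mem_Icc hα hβ S R.one_le_leaveStep R.leaveStep_mono (fun t => ?_) hpS ?_ ?_
    · rw [hS, Finset.filter_filter, lvCount]
      simp only [and_comm]
    · rw [← hpc]
      linarith
    · rw [hpc, mul_comm]
  have h1 := R.arrival_sub_leaveStep_le hν hτ hα hβ hκ0 hV p hu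
  have h2 := R.leaveStep_sub_arrival_le hν hτ hα hβ hκ0 hV p hu
  set kv := ku + τ + (Gin R ku - cumul hout (ku + τ)) / ν with hkv
  have h3 : ν * (ku + τ) + (Gin R ku - cumul hout (ku + τ)) = ν * kv := by
    rw [hkv]
    field_simp
  rw [h3] at h1 h2
  have h4 : |kv - R.leaveStep p * α| ≤ (2 * κ + 2 * ν + 1) / ν * α := by
    have hmul : |kv - R.leaveStep p * α| * ν = |(kv - R.leaveStep p * α) * ν| := by
      rw [abs_mul, abs_of_pos hν]
    rw [div_mul_eq_mul_div, le_div_iff₀ hν, hmul, abs_le]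
    have h5 : 0 ≤ κ * α := by positivity
    have h6 : 0 ≤ ν * α := by positivity
    constructor <;> nlinarith
  have h7 : α ≤ Real.sqrt α := Real.le_sqrt_of_sq_le (by nlinarith)
  have h8 : |kv - sInf {x : ℝ | 0 ≤ x ∧ (⌈φ / β⌉₊ : ℝ) * β ≤ Goutj R j x}|
      ≤ ((2 * κ + 2 * ν + 1) / ν + 1) * α := by
    have h9 := abs_le.1 h4
    rw [abs_le]
    constructor <;> linarith [hv.1, hv.2]
  calc _ ≤ ((2 * κ + 2 * ν + 1) / ν + 1) * α := h8
    _ ≤ ((2 * κ + 2 * ν + 1) / ν + 1) * Real.sqrt α :=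
        mul_le_mul_of_nonneg_left h7 (by positivity)
    _ ≤ _ := le_add_of_nonneg_right (by positivity)
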